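/- arXiv:0907.1421 — 3 statements merged into one kernel-verified Lean document; each statement's English description precedes it below -/
import Mathlib

section
/- Let G be a finite simple graph whose vertex set is partitioned into four sets S, N, A, Z such that: S is an independent set; every vertex of N has a neighbour in S, and every neighbour of every vertex of S lies in N (that is, N = N_G(S)); every vertex of Z has degree at least 7 in G; every vertex of A has degree at least 4 in G and has at least three neighbours in N; every vertex of N has at least three neighbours in N; and |N| ≤ 6|S|. Let g ≥ 1 be an integer such that |E(G)| = 3(|V(G)| + g − 2) and |S| ≤ g. Then |V(G)| ≤ 25g − 12. -/
namespace SimpleGraph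

variable {V : Type*} [Fintype V] [DecidableEq V] (G : SimpleGraph V) [DecidableRel G.Adj]

/-- Double counting of the edges between two vertex sets. -/
theorem sum_card_neighborFinset_inter_comm (X Y : Finset V) :
    ∑ x ∈ X, (G.neighborFinset x ∩ Y).card = ∑ y ∈ Y, (G.neighborFinset y ∩ X).card := by
  have key (v : V) (T : Finset V) :
      (G.neighborFinset v ∩ T).card = ∑ w ∈ T, if G.Adj v w then 1 else 0 := by
    rw [← Finset.card_filter]
    congr 1
    ext w
    simp [and_comm]
  simp only [key]
  rw [Finset.sum_comm]
  simp only [G.adj_comm]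

/-- The neighbours of a vertex in three pairwise disjoint sets number at most its degree. -/
theorem card_neighborFinset_inter_add_le_degree (v : V) {X Y W : Finset V}
    (hXY : Disjoint X Y) (hXW : Disjoint X W) (hYW : Disjoint Y W) :
    (G.neighborFinset v ∩ X).card + (G.neighborFinset v ∩ Y).card +
      (G.neighborFinset v ∩ W).card ≤ G.degree v := by
  have hdisj : Disjoint (X ∪ Y) W := Finset.disjoint_union_left.2 ⟨hXW, hYW⟩
  rw [← Finset.card_union_of_disjoint (hXY.mono Finset.inter_subset_right Finset.inter_subset_right),
    ← Finset.inter_union_distrib_left,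
    ← Finset.card_union_of_disjoint (hdisj.mono Finset.inter_subset_right Finset.inter_subset_right),
    ← Finset.inter_union_distrib_left, ← G.card_neighborFinset_eq_degree]
  exact Finset.card_le_card Finset.inter_subset_left

end SimpleGraph

/-- The combinatorial core of the proof that every irreducible triangulation of a
surface of Euler genus `g ≥ 1` has at most `25g - 12` vertices. -/
theorem vertex_bound_25g
    {V : Type*} [Fintype V] [DecidableEq V]
    (G : SimpleGraph V) [DecidableRel G.Adj]
    (S N A Z : Finset V)
    -- S, N, A, Z partition the vertex set
    (hSN : Disjoint S N) (hSA : Disjoint S A) (hSZ : Disjoint S Z)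
    (hNA : Disjoint N A) (hNZ : Disjoint N Z) (hAZ : Disjoint A Z)
    (hcover : S ∪ N ∪ A ∪ Z = Finset.univ)
    -- S is an independent set
    (hindep : ∀ u ∈ S, ∀ v ∈ S, ¬ G.Adj u v)
    -- N = N_G(S)
    (hN1 : ∀ v ∈ N, ∃ u ∈ S, G.Adj u v)
    (hN2 : ∀ u ∈ S, ∀ v : V, G.Adj u v → v ∈ N)
    -- every vertex of Z has degree at least 7
    (hZ : ∀ v ∈ Z, 7 ≤ G.degree v)
    -- every vertex of A has degree at least 4 and at least 3 neighbours in N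
    (hAdeg : ∀ v ∈ A, 4 ≤ G.degree v)
    (hAN : ∀ v ∈ A, 3 ≤ (G.neighborFinset v ∩ N).card)
    -- every vertex of N has at least 3 neighbours in N
    (hNN : ∀ v ∈ N, 3 ≤ (G.neighborFinset v ∩ N).card)
    -- |N| ≤ 6|S|
    (hNS : N.card ≤ 6 * S.card)
    (g : ℤ) (hg : 1 ≤ g)
    -- Euler's formula count: |E(G)| = 3(|V(G)| + g - 2)
    (hEuler : (G.edgeFinset.card : ℤ) = 3 * ((Fintype.card V : ℤ) + g - 2))
    -- |S| ≤ g
    (hSg : (S.card : ℤ) ≤ g) :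
    (Fintype.card V : ℤ) ≤ 25 * g - 12 := by
  have hSNA : Disjoint (S ∪ N) A := Finset.disjoint_union_left.2 ⟨hSA, hNA⟩
  have hSNAZ : Disjoint (S ∪ N ∪ A) Z :=
    Finset.disjoint_union_left.2 ⟨Finset.disjoint_union_left.2 ⟨hSZ, hNZ⟩, hAZ⟩
  have hcard : Fintype.card V = S.card + N.card + A.card + Z.card := by
    rw [← Finset.card_univ, ← hcover, Finset.card_union_of_disjoint hSNAZ,
      Finset.card_union_of_disjoint hSNA, Finset.card_union_of_disjoint hSN]
  have hdegsum := G.sum_degrees_eq_twice_card_edges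
  rw [← hcover, Finset.sum_union hSNAZ, Finset.sum_union hSNA, Finset.sum_union hSN] at hdegsum
  have hedgeSN : N.card ≤ ∑ v ∈ N, (G.neighborFinset v ∩ S).card := by
    rw [Finset.card_eq_sum_ones]
    refine Finset.sum_le_sum fun v hv => ?_
    obtain ⟨u, hu, huv⟩ := hN1 v hv
    exact Finset.card_pos.2 ⟨u, by simp [hu, huv.symm]⟩
  have hsumS : ∑ v ∈ N, (G.neighborFinset v ∩ S).card ≤ ∑ u ∈ S, G.degree u := by
    rw [G.sum_card_neighborFinset_inter_comm]
    refine Finset.sum_le_sum fun u _ => ?_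
    rw [← G.card_neighborFinset_eq_degree]
    exact Finset.card_le_card Finset.inter_subset_left
  have hedgeNN := Finset.card_nsmul_le_sum N _ 3 hNN
  have hedgeNA := Finset.card_nsmul_le_sum A _ 3 hAN
  rw [G.sum_card_neighborFinset_inter_comm] at hedgeNA
  have hsumN := Finset.sum_le_sum fun v (_ : v ∈ N) =>
    G.card_neighborFinset_inter_add_le_degree v hSN hSA hNA
  rw [Finset.sum_add_distrib, Finset.sum_add_distrib] at hsumN
  have hsumA := Finset.card_nsmul_le_sum A _ 4 hAdeg
  have hsumZ := Finset.card_nsmul_le_sum Z _ 7 hZ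
  simp only [smul_eq_mul] at hedgeNN hedgeNA hsumA hsumZ
  omega
end

section
/- Let G be a finite simple graph and let S be a good independent set of G all of whose vertices have degree at most 9 in G, such that φ(S) ⪰ φ(S') for every good independent set S' of G all of whose vertices have degree at most 9. Let i ∈ {4,5,6,7,8,9} and let v be a vertex of G with v ∉ V(H_i) and 4 ≤ deg_G(v) ≤ i. Then v has at least three neighbours in some connected component of H_i (where H_i is defined with respect to S). -/
open SimpleGraph

variable {V : Type*}

/-- `Gv G v` is the subgraph of `G` induced by `{v} ∪ N_G(v)`. -/
def Gv (G : SimpleGraph V) (v : V) : G.Subgraph :=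
  (⊤ : G.Subgraph).induce ({v} ∪ G.neighborSet v)

/-- Two subgraphs of `G` are compatible if they have at most two vertices in common. -/
def Compatible (G : SimpleGraph V) (H₁ H₂ : G.Subgraph) : Prop :=
  (H₁.verts ∩ H₂.verts).ncard ≤ 2

/-- Binary trees whose leaves are labelled by vertices. -/
inductive RepTree (V : Type*) where
  | leaf : V → RepTree V
  | node : RepTree V → RepTree V → RepTree V

namespace RepTree

/-- The list of (labels of) leaves of a binary tree. -/
def leaves : RepTree V → List V
  | leaf v => [v]
  | node a b => leaves a ++ leaves b

/-- The subgraph `G⟨x⟩` associated with a node `x`, given the assignment `f` of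
subgraphs to leaves: the union of the subgraphs at the leaves below `x`. -/
def graphOf (G : SimpleGraph V) (f : V → G.Subgraph) : RepTree V → G.Subgraph
  | leaf v => f v
  | node a b => graphOf G f a ⊔ graphOf G f b

/-- The tree, with subgraphs assigned to its leaves by `f`, is a tree
representation in `G`: the subgraphs `G⟨a⟩` and `G⟨b⟩` are compatible whenever
`a` and `b` are children of a common node. -/
def IsRep (G : SimpleGraph V) (f : V → G.Subgraph) : RepTree V → Prop
  | leaf _ => True
  | node a b => IsRep G f a ∧ IsRep G f b ∧ Compatible G (graphOf G f a) (graphOf G f b)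

/-- `IsNode x T` means that `x` is (the subtree rooted at) a node of `T`. -/
inductive IsNode : RepTree V → RepTree V → Prop
  | refl (t : RepTree V) : IsNode t t
  | left {x a b : RepTree V} : IsNode x a → IsNode x (node a b)
  | right {x a b : RepTree V} : IsNode x b → IsNode x (node a b)

end RepTree

variable [Fintype V] [DecidableEq V]

/-- `Ŝ_i = S_4 ∪ ⋯ ∪ S_i`, the set of vertices of `S` whose degree lies in `[4, i]`. -/
def Shat (G : SimpleGraph V) [DecidableRel G.Adj] (S : Finset V) (i : ℕ) : Finset V :=
  S.filter fun v => 4 ≤ G.degree v ∧ G.degree v ≤ i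

/-- `H_i := ⋃_{v ∈ Ŝ_i} G_v`. -/
def Hsub (G : SimpleGraph V) [DecidableRel G.Adj] (S : Finset V) (i : ℕ) : G.Subgraph :=
  ⨆ v ∈ Shat G S i, Gv G v

/-- `C` is a connected component of `H`: a maximal connected subgraph of `H`. -/
def IsComponent (G : SimpleGraph V) (H C : G.Subgraph) : Prop :=
  C.Connected ∧ C ≤ H ∧ ∀ D : G.Subgraph, C ≤ D → D ≤ H → D.Connected → D = C

/-- `S` is good: there is a tree representation `(T, {G_u : u ∈ S})` respecting `S`
such that for every `i ∈ [4,9]` and every connected component `X` of `H_i` there is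
a node `x` of `T` with `X = G⟨x⟩`. -/
def IsGood (G : SimpleGraph V) [DecidableRel G.Adj] (S : Finset V) : Prop :=
  ∃ T : RepTree V, T.leaves.Nodup ∧ T.leaves.toFinset = S ∧
    RepTree.IsRep G (Gv G) T ∧
    ∀ i : ℕ, 4 ≤ i → i ≤ 9 → ∀ X : G.Subgraph, IsComponent G (Hsub G S i) X →
      ∃ x : RepTree V, RepTree.IsNode x T ∧ RepTree.graphOf G (Gv G) x = X

/-- `φ(S) = (|S_4|, |S_5|, …, |S_9|)`. -/
def phi (G : SimpleGraph V) [DecidableRel G.Adj] (S : Finset V) : Fin 6 → ℕ :=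
  fun k => (S.filter fun v => G.degree v = k.1 + 4).card

/-- Strict lexicographic order on the vectors `φ(S)`. -/
def PhiGT (a b : Fin 6 → ℕ) : Prop :=
  ∃ j : Fin 6, (∀ k : Fin 6, k < j → a k = b k) ∧ b j < a j

/-- `⪰` : strict lexicographic order or equality. -/
def PhiGE (a b : Fin 6 → ℕ) : Prop := PhiGT a b ∨ a = b

namespace RepTree

section

variable {V : Type*} {G : SimpleGraph V} {f : V → G.Subgraph}

theorem mem_verts_graphOf {t : RepTree V} {u : V} :
    u ∈ (graphOf G f t).verts ↔ ∃ w ∈ t.leaves, u ∈ (f w).verts := by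
  induction t with
  | leaf w => simp [graphOf, leaves]
  | node a b iha ihb => simp [graphOf, leaves, iha, ihb, or_and_right, exists_or]

theorem leaves_ne_nil (t : RepTree V) : t.leaves ≠ [] := by
  induction t with
  | leaf w => simp [leaves]
  | node a b iha ihb => simp [leaves, iha]

theorem IsNode.trans {x y t : RepTree V} (hxy : IsNode x y) (hyt : IsNode y t) : IsNode x t := by
  induction hyt with
  | refl => exact hxy
  | left _ ih => exact .left ih
  | right _ ih => exact .right ih

theorem IsNode.leaves_sublist {x t : RepTree V} (h : IsNode x t) :
    x.leaves.Sublist t.leaves := by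
  induction h with
  | refl => exact .refl _
  | left _ ih => exact ih.trans (List.sublist_append_left _ _)
  | right _ ih => exact ih.trans (List.sublist_append_right _ _)

theorem IsNode.graphOf_le {x t : RepTree V} (h : IsNode x t) :
    graphOf G f x ≤ graphOf G f t := by
  induction h with
  | refl => exact le_rfl
  | left _ ih => exact ih.trans le_sup_left
  | right _ ih => exact ih.trans le_sup_right

theorem IsNode.isRep {x t : RepTree V} (h : IsNode x t) (ht : IsRep G f t) : IsRep G f x := by
  induction h with
  | refl => exact ht
  | left _ ih => exact ih ht.1
  | right _ ih => exact ih ht.2.1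

/-- Two nodes of a tree with distinct leaves which share a leaf are comparable. -/
theorem IsNode.comparable {x y t : RepTree V} (hx : IsNode x t) (hy : IsNode y t)
    (ht : t.leaves.Nodup) {u : V} (hux : u ∈ x.leaves) (huy : u ∈ y.leaves) :
    IsNode x y ∨ IsNode y x := by
  induction t with
  | leaf w => cases hx; exact .inr hy
  | node a b iha ihb =>
    obtain ⟨ha, hb, hab⟩ := List.nodup_append'.mp ht
    cases hx with
    | refl => exact .inr hy
    | left hx =>
      cases hy with
      | refl => exact .inl (.left hx)
      | left hy => exact iha hx hy ha
      | right hy => exact (hab (hx.leaves_sublist.subset hux) (hy.leaves_sublist.subset huy)).elim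
    | right hx =>
      cases hy with
      | refl => exact .inl (.right hx)
      | left hy => exact (hab (hy.leaves_sublist.subset huy) (hx.leaves_sublist.subset hux)).elim
      | right hy => exact ihb hx hy hb

/-- Attach the trees of a list to `t` one after the other, starting with the last. -/
def attach (t : RepTree V) : List (RepTree V) → RepTree V
  | [] => t
  | x :: l => node (attach t l) x

variable {t : RepTree V}

theorem attach_append (l₁ l₂ : List (RepTree V)) :
    t.attach (l₁ ++ l₂) = (t.attach l₂).attach l₁ := by
  induction l₁ with
  | nil => rfl
  | cons x l ih => simp [attach, ih]

theorem isNode_attach_self (l : List (RepTree V)) : IsNode t (t.attach l) := by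
  induction l with
  | nil => exact .refl _
  | cons x l ih => exact .left ih

theorem isNode_attach_of_mem {l : List (RepTree V)} {x : RepTree V} (hx : x ∈ l) :
    IsNode x (t.attach l) := by
  induction l with
  | nil => simp at hx
  | cons y l ih =>
    rcases List.mem_cons.mp hx with rfl | hx
    · exact .right (.refl _)
    · exact .left (ih hx)

theorem mem_leaves_attach {l : List (RepTree V)} {u : V} :
    u ∈ (t.attach l).leaves ↔ u ∈ t.leaves ∨ ∃ x ∈ l, u ∈ x.leaves := by
  induction l with
  | nil => simp [attach]
  | cons y l ih =>
    simp only [attach, leaves, List.mem_append, ih, List.exists_mem_cons_iff]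
    rw [or_assoc, or_comm (b := _ ∈ _)]

theorem mem_verts_graphOf_attach {l : List (RepTree V)} {u : V} :
    u ∈ (graphOf G f (t.attach l)).verts ↔
      u ∈ (graphOf G f t).verts ∨ ∃ x ∈ l, u ∈ (graphOf G f x).verts := by
  induction l with
  | nil => simp [attach]
  | cons y l ih =>
    simp only [attach, graphOf, Subgraph.verts_sup, Set.mem_union, ih, List.exists_mem_cons_iff]
    rw [or_assoc, or_comm (b := _ ∈ _)]

theorem graphOf_attach_le {l : List (RepTree V)} {K : G.Subgraph} :
    graphOf G f (t.attach l) ≤ K ↔ graphOf G f t ≤ K ∧ ∀ x ∈ l, graphOf G f x ≤ K := by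
  induction l with
  | nil => simp [attach]
  | cons y l ih =>
    simp only [attach, graphOf, sup_le_iff, ih, List.forall_mem_cons]
    tauto

theorem nodup_leaves_attach {l : List (RepTree V)} (ht : t.leaves.Nodup)
    (hl : ∀ x ∈ l, x.leaves.Nodup) (htl : ∀ x ∈ l, t.leaves.Disjoint x.leaves)
    (hp : l.Pairwise fun x y => x.leaves.Disjoint y.leaves) : (t.attach l).leaves.Nodup := by
  induction l with
  | nil => exact ht
  | cons y l ih =>
    simp only [List.forall_mem_cons, List.pairwise_cons] at hl htl hp
    refine List.nodup_append'.mpr ⟨ih hl.2 htl.2 hp.2, hl.1, fun u hu huy => ?_⟩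
    rcases mem_leaves_attach.mp hu with hu | ⟨x, hx, hu⟩
    · exact htl.1 hu huy
    · exact hp.1 x hx huy hu

theorem isRep_attach {l : List (RepTree V)} (ht : IsRep G f t) (hl : ∀ x ∈ l, IsRep G f x)
    (htl : ∀ x ∈ l, Compatible G (graphOf G f t) (graphOf G f x))
    (hp : l.Pairwise fun x y => Disjoint (graphOf G f x).verts (graphOf G f y).verts) :
    IsRep G f (t.attach l) := by
  induction l with
  | nil => exact ht
  | cons y l ih =>
    simp only [List.forall_mem_cons, List.pairwise_cons] at hl htl hp
    refine ⟨ih hl.2 htl.2 hp.2, hl.1, ?_⟩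
    have h : (graphOf G f (t.attach l)).verts ∩ (graphOf G f y).verts =
        (graphOf G f t).verts ∩ (graphOf G f y).verts := by
      ext u
      simp only [Set.mem_inter_iff, mem_verts_graphOf_attach]
      refine ⟨fun ⟨hu, huy⟩ => ⟨hu.resolve_right ?_, huy⟩, fun ⟨hu, huy⟩ => ⟨.inl hu, huy⟩⟩
      rintro ⟨x, hx, hux⟩
      exact Set.disjoint_left.mp (hp.1 x hx) huy hux
    rw [Compatible, h]
    exact htl.1

theorem connected_graphOf_attach {l : List (RepTree V)} (ht : (graphOf G f t).Connected)
    (hl : ∀ x ∈ l, (graphOf G f x).Connected)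
    (htl : ∀ x ∈ l, ((graphOf G f t).verts ∩ (graphOf G f x).verts).Nonempty) :
    (graphOf G f (t.attach l)).Connected := by
  induction l with
  | nil => exact ht
  | cons y l ih =>
    simp only [List.forall_mem_cons] at hl htl
    refine Subgraph.connected_sup (ih hl.2 htl.2).preconnected hl.1.preconnected ?_
    obtain ⟨u, hu, huy⟩ := htl.1
    exact ⟨u, mem_verts_graphOf_attach.mpr (.inl hu), huy⟩

end

end RepTree

section

variable {V : Type*} {G : SimpleGraph V}

theorem mem_verts_Gv {v u : V} : u ∈ (Gv G v).verts ↔ u = v ∨ G.Adj v u := by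
  simp [Gv]

theorem self_mem_verts_Gv (v : V) : v ∈ (Gv G v).verts := mem_verts_Gv.mpr (.inl rfl)

theorem Gv_connected (v : V) : (Gv G v).Connected := by
  rw [Subgraph.connected_iff', connected_iff_exists_forall_reachable]
  refine ⟨⟨v, self_mem_verts_Gv v⟩, fun ⟨u, hu⟩ => ?_⟩
  rcases mem_verts_Gv.mp hu with rfl | h
  · exact .rfl
  · refine Adj.reachable ?_
    simp [Gv, h]

/-- A connected subgraph of a disjoint union lies in any part that it meets. -/
theorem SimpleGraph.Subgraph.Connected.le_left_of_le_sup {C A B : G.Subgraph} (hC : C.Connected)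
    (hle : C ≤ A ⊔ B) (hAB : Disjoint A.verts B.verts) (hA : (C.verts ∩ A.verts).Nonempty) :
    C ≤ A := by
  obtain ⟨a, haC, haA⟩ := hA
  have key : ∀ x : C.verts, (x : V) ∈ A.verts := by
    intro x
    by_contra hx
    obtain ⟨p⟩ := hC.coe.preconnected ⟨a, haC⟩ x
    obtain ⟨⟨⟨y, z⟩, hyz⟩, -, hy, hz⟩ := p.exists_boundary_dart {y | (y : V) ∈ A.verts} haA hx
    rcases hle.2 hyz with h | h
    · exact hz (A.edge_vert h.symm)
    · exact Set.disjoint_left.mp hAB hy (B.edge_vert h)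
  refine ⟨fun x hx => key ⟨x, hx⟩, fun x y hxy => ?_⟩
  rcases hle.2 hxy with h | h
  · exact h
  · exact (Set.disjoint_left.mp hAB (key ⟨x, C.edge_vert hxy⟩) (B.edge_vert h)).elim

theorem IsComponent.eq_of_mem {H C D : G.Subgraph} (hC : IsComponent G H C)
    (hD : IsComponent G H D) {u : V} (huC : u ∈ C.verts) (huD : u ∈ D.verts) : C = D := by
  have h : (C ⊔ D).Connected :=
    Subgraph.connected_sup hC.1.preconnected hD.1.preconnected ⟨u, huC, huD⟩
  have hle := sup_le hC.2.1 hD.2.1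
  exact (hC.2.2 _ le_sup_left hle h).symm.trans (hD.2.2 _ le_sup_right hle h)

theorem exists_isComponent_ge [Finite V] {H D : G.Subgraph} (hD : D.Connected) (hle : D ≤ H) :
    ∃ C, IsComponent G H C ∧ D ≤ C := by
  obtain ⟨C, hDC, hC⟩ := (Set.toFinite {C : G.Subgraph | C.Connected ∧ C ≤ H}).exists_le_maximal
    (Set.mem_ofPred.mpr ⟨hD, hle⟩)
  exact ⟨C, ⟨hC.prop.1, hC.prop.2, fun E hCE hEH hE => hC.eq_of_ge ⟨hE, hEH⟩ hCE⟩, hDC⟩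

end

theorem not_PhiGE_of_PhiGT {a b : Fin 6 → ℕ} (h : PhiGT b a) : ¬ PhiGE a b := by
  obtain ⟨j, hj, hlt⟩ := h
  rintro (⟨k, hk, hlt'⟩ | rfl)
  · rcases lt_trichotomy j k with h | rfl | h
    · exact hlt.ne (hk j h)
    · omega
    · exact hlt'.ne (hj k h)
  · exact hlt.false

section

variable {W : Type*} [Fintype W] {G : SimpleGraph W} [DecidableRel G.Adj] {S : Finset W}

theorem mem_Shat {i : ℕ} {u : W} :
    u ∈ Shat G S i ↔ u ∈ S ∧ 4 ≤ G.degree u ∧ G.degree u ≤ i := by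
  simp [Shat]

theorem Gv_le_Hsub {i : ℕ} {u : W} (hu : u ∈ Shat G S i) : Gv G u ≤ Hsub G S i :=
  le_iSup₂_of_le u hu le_rfl

theorem Hsub_le {i : ℕ} {K : G.Subgraph} :
    Hsub G S i ≤ K ↔ ∀ u ∈ Shat G S i, Gv G u ≤ K := iSup₂_le_iff

theorem Hsub_mono {i j : ℕ} (hij : i ≤ j) : Hsub G S i ≤ Hsub G S j :=
  Hsub_le.mpr fun _ hu => Gv_le_Hsub <|
    mem_Shat.mpr ((mem_Shat.mp hu).imp_right (And.imp_right (le_trans · hij)))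

theorem mem_Shat_of_mem_verts {i : ℕ} (hS : ∀ u ∈ S, ∀ w ∈ S, ¬ G.Adj u w) {u : W}
    (hu : u ∈ S) (huH : u ∈ (Hsub G S i).verts) : u ∈ Shat G S i := by
  simp only [Hsub, Subgraph.verts_iSup, Set.mem_iUnion] at huH
  obtain ⟨w, hw, huw⟩ := huH
  rcases mem_verts_Gv.mp huw with rfl | h
  · exact hw
  · exact (hS w (mem_Shat.mp hw).1 u hu h).elim

variable [DecidableEq W]

theorem Shat_insert_Shat_of_lt {v : W} {j : ℕ} (hj : j < G.degree v) :
    Shat G (insert v (Shat G S (G.degree v))) j = Shat G S j := by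
  ext u
  simp only [mem_Shat, Finset.mem_insert]
  constructor
  · rintro ⟨rfl | h, h'⟩
    · omega
    · exact ⟨h.1, h'⟩
  · exact fun h => ⟨.inr ⟨h.1, by omega⟩, h.2⟩

theorem Hsub_insert_Shat_of_le {v : W} {j : ℕ} (hv : 4 ≤ G.degree v) (hj : G.degree v ≤ j) :
    Hsub G (insert v (Shat G S (G.degree v))) j = Gv G v ⊔ Hsub G S (G.degree v) := by
  have : Shat G (insert v (Shat G S (G.degree v))) j = insert v (Shat G S (G.degree v)) := by
    ext u
    simp only [mem_Shat, Finset.mem_insert]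
    constructor
    · exact fun h => h.1
    · rintro (rfl | h)
      · exact ⟨.inl rfl, hv, hj⟩
      · exact ⟨.inr h, by omega⟩
  rw [Hsub, this, Finset.iSup_insert, Hsub]

theorem phiGT_insert_Shat {v : W} (hvS : v ∉ S) (hv4 : 4 ≤ G.degree v) (hv9 : G.degree v ≤ 9) :
    PhiGT (phi G (insert v (Shat G S (G.degree v)))) (phi G S) := by
  refine ⟨⟨G.degree v - 4, by omega⟩, fun k hk => ?_, ?_⟩
  · have hk : k.1 < G.degree v - 4 := hk
    simp only [phi]
    congr 1
    ext u
    simp only [Finset.mem_filter, Finset.mem_insert, mem_Shat]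
    constructor
    · rintro ⟨rfl | h, h'⟩
      · omega
      · exact ⟨h.1, h'⟩
    · exact fun h => ⟨.inr ⟨h.1, by omega⟩, h.2⟩
  · simp only [phi]
    refine Finset.card_lt_card (Finset.ssubset_iff_of_subset ?_ |>.mpr ⟨v, ?_, ?_⟩)
    · intro u
      simp only [Finset.mem_filter, Finset.mem_insert, mem_Shat]
      exact fun h => ⟨.inr ⟨h.1, by omega⟩, h.2⟩
    · simp only [Finset.mem_filter, Finset.mem_insert, true_or, true_and]
      omega
    · simp [hvS]

open RepTree in
/-- Adding to `Ŝ_d` a vertex of degree `d` outside `H_d` which is compatible with every component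
of `H_d` preserves goodness. -/
theorem IsGood.insert_Shat {v : W} (hS : ∀ u ∈ S, ∀ w ∈ S, ¬ G.Adj u w) (hgood : IsGood G S)
    (hv4 : 4 ≤ G.degree v) (hv9 : G.degree v ≤ 9) (hv : v ∉ (Hsub G S (G.degree v)).verts)
    (hcomp : ∀ X, IsComponent G (Hsub G S (G.degree v)) X → Compatible G (Gv G v) X) :
    IsGood G (insert v (Shat G S (G.degree v))) := by
  classical
  obtain ⟨T, hTn, rfl, hTrep, hT⟩ := hgood
  set H := Hsub G T.leaves.toFinset (G.degree v) with hH
  have hτ : ∀ X, ∃ x, IsComponent G H X → IsNode x T ∧ graphOf G (Gv G) x = X := fun X => by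
    by_cases hX : IsComponent G H X
    · exact (hT _ hv4 hv9 X hX).imp fun _ h _ => h
    · exact ⟨T, fun h => (hX h).elim⟩
  choose τ hτ using hτ
  have hτT (X) (hX : IsComponent G H X) : IsNode (τ X) T := (hτ X hX).1
  replace hτ (X) (hX : IsComponent G H X) : graphOf G (Gv G) (τ X) = X := (hτ X hX).2
  have mem_comp {X : G.Subgraph} (hX : IsComponent G H X) {u : W} (hu : u ∈ (τ X).leaves) :
      u ∈ X.verts := by
    rw [← hτ X hX]
    exact mem_verts_graphOf.mpr ⟨u, hu, self_mem_verts_Gv u⟩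
  have mem_leaves {X : G.Subgraph} (hX : IsComponent G H X) {u : W} (huT : u ∈ T.leaves)
      (hu : u ∈ X.verts) : u ∈ (τ X).leaves := by
    rw [← hτ X hX] at hu
    obtain ⟨w, hw, huw⟩ := mem_verts_graphOf.mp hu
    rcases mem_verts_Gv.mp huw with rfl | h
    · exact hw
    · exact (hS w (by simpa using (hτT X hX).leaves_sublist.subset hw) u (by simpa using huT)
        h).elim
  let 𝒞 : List G.Subgraph := (Set.toFinite {X | IsComponent G H X}).toFinset.toList
  have h𝒞 {X} : X ∈ 𝒞 ↔ IsComponent G H X := by simp [𝒞]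
  let meets (X : G.Subgraph) : Prop := ((Gv G v).verts ∩ X.verts).Nonempty
  let l₁ := (𝒞.filter fun X => ¬ meets X).map τ
  let l₂ := (𝒞.filter fun X => meets X).map τ
  have hl {x} : x ∈ l₁ ++ l₂ ↔ ∃ X, IsComponent G H X ∧ τ X = x := by
    simp only [l₁, l₂, List.mem_append, List.mem_map, List.mem_filter, h𝒞, decide_eq_true_eq]
    grind
  have hl₂ {x} : x ∈ l₂ ↔ ∃ X, IsComponent G H X ∧ meets X ∧ τ X = x := by
    simp only [l₂, List.mem_map, List.mem_filter, h𝒞, decide_eq_true_eq, and_assoc]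
  have hdisj {X Y : G.Subgraph} (hX : IsComponent G H X) (hY : IsComponent G H Y) (hXY : X ≠ Y) :
      Disjoint X.verts Y.verts :=
    Set.disjoint_left.mpr fun u hu hu' => hXY (hX.eq_of_mem hY hu hu')
  have hpair : (l₁ ++ l₂).Pairwise fun x y =>
      Disjoint (graphOf G (Gv G) x).verts (graphOf G (Gv G) y).verts := by
    rw [← List.map_append, List.pairwise_map]
    have hnodup : 𝒞.Nodup := Finset.nodup_toList _
    refine List.Nodup.pairwise_of_forall_ne (List.nodup_append'.mpr
      ⟨hnodup.filter _, hnodup.filter _, fun X hX hX' => ?_⟩) fun X hX Y hY hXY => ?_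
    · simp_all
    · have hX : IsComponent G H X := h𝒞.mp (by grind)
      have hY : IsComponent G H Y := h𝒞.mp (by grind)
      rw [hτ X hX, hτ Y hY]
      exact hdisj hX hY hXY
  have hnode {X : G.Subgraph} (hX : IsComponent G H X) :
      IsNode (τ X) ((leaf v).attach (l₁ ++ l₂)) :=
    isNode_attach_of_mem (hl.mpr ⟨X, hX, rfl⟩)
  refine ⟨(leaf v).attach (l₁ ++ l₂), ?_, ?_, ?_, ?_⟩
  · refine nodup_leaves_attach (by simp [leaves]) ?_ ?_ (hpair.imp fun {x y} h u hx hy => ?_)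
    · intro x hx
      obtain ⟨X, hX, rfl⟩ := hl.mp hx
      exact hTn.sublist (hτT X hX).leaves_sublist
    · intro x hx
      obtain ⟨X, hX, rfl⟩ := hl.mp hx
      simp only [leaves, List.singleton_disjoint]
      exact fun h => hv (hX.2.1.1 (mem_comp hX h))
    · exact Set.disjoint_left.mp h (mem_verts_graphOf.mpr ⟨u, hx, self_mem_verts_Gv u⟩)
        (mem_verts_graphOf.mpr ⟨u, hy, self_mem_verts_Gv u⟩)
  · ext u
    simp only [List.mem_toFinset, mem_leaves_attach, leaves, List.mem_singleton,
      Finset.mem_insert]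
    refine or_congr_right ⟨?_, fun hu => ?_⟩
    · rintro ⟨x, hx, hu⟩
      obtain ⟨X, hX, rfl⟩ := hl.mp hx
      exact mem_Shat_of_mem_verts hS
        (List.mem_toFinset.mpr ((hτT X hX).leaves_sublist.subset hu))
        (hX.2.1.1 (mem_comp hX hu))
    · obtain ⟨X, hX, huX⟩ := exists_isComponent_ge (Gv_connected u) (Gv_le_Hsub hu)
      exact ⟨τ X, hl.mpr ⟨X, hX, rfl⟩, mem_leaves hX (List.mem_toFinset.mp (mem_Shat.mp hu).1)
        (huX.1 (self_mem_verts_Gv u))⟩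
  · refine isRep_attach trivial ?_ ?_ hpair
    · intro x hx
      obtain ⟨X, hX, rfl⟩ := hl.mp hx
      exact (hτT X hX).isRep hTrep
    · intro x hx
      obtain ⟨X, hX, rfl⟩ := hl.mp hx
      rw [hτ X hX]
      exact hcomp X hX
  · intro j hj4 hj9 C hC
    rcases lt_or_ge j (G.degree v) with hj | hj
    · rw [Hsub, Shat_insert_Shat_of_lt hj] at hC
      obtain ⟨x, hxT, hx⟩ := hT j hj4 hj9 C hC
      obtain ⟨X, hX, hCX⟩ := exists_isComponent_ge hC.1 (hC.2.1.trans (Hsub_mono hj.le))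
      obtain ⟨u, hu⟩ := List.exists_mem_of_ne_nil _ x.leaves_ne_nil
      have huC : u ∈ C.verts := hx ▸ mem_verts_graphOf.mpr ⟨u, hu, self_mem_verts_Gv u⟩
      have huX : u ∈ (τ X).leaves :=
        mem_leaves hX (hxT.leaves_sublist.subset hu) (hCX.1 huC)
      rcases hxT.comparable (hτT X hX) hTn hu huX with h | h
      · exact ⟨x, h.trans (hnode hX), hx⟩
      · refine ⟨τ X, hnode hX, (hτ X hX).trans (le_antisymm ?_ hCX)⟩
        rw [← hx, ← hτ X hX]
        exact h.graphOf_le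
    · rw [Hsub_insert_Shat_of_le hv4 hj, ← hH] at hC
      let Y := graphOf G (Gv G) ((leaf v).attach l₂)
      let Z : G.Subgraph := sSup {X | IsComponent G H X ∧ ¬ meets X}
      have hYle : Y ≤ Gv G v ⊔ H := by
        refine graphOf_attach_le.mpr ⟨le_sup_left, fun x hx => ?_⟩
        obtain ⟨X, hX, -, rfl⟩ := hl₂.mp hx
        rw [hτ X hX]
        exact hX.2.1.trans le_sup_right
      have hZle : Z ≤ H := sSup_le fun X hX => hX.1.2.1
      have hYconn : Y.Connected := by
        refine connected_graphOf_attach (Gv_connected v) ?_ ?_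
        all_goals
          intro x hx
          obtain ⟨X, hX, hm, rfl⟩ := hl₂.mp hx
          rw [hτ X hX]
        exacts [hX.1, hm]
      have hle : Gv G v ⊔ H ≤ Y ⊔ Z := by
        obtain ⟨hvY, hxY⟩ := graphOf_attach_le.mp (le_refl Y)
        refine sup_le (hvY.trans le_sup_left) (Hsub_le.mpr fun u hu => ?_)
        obtain ⟨X, hX, huX⟩ := exists_isComponent_ge (Gv_connected u) (Gv_le_Hsub hu)
        refine huX.trans ?_
        by_cases hm : meets X
        · rw [← hτ X hX]
          exact (hxY _ (hl₂.mpr ⟨X, hX, hm, rfl⟩)).trans le_sup_left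
        · have hXZ : X ≤ Z := le_sSup (Set.mem_ofPred.mpr ⟨hX, hm⟩)
          exact hXZ.trans le_sup_right
      have hYZ : Disjoint Y.verts Z.verts := by
        refine Set.disjoint_left.mpr fun u huY huZ => ?_
        simp only [Z, Subgraph.verts_sSup, Set.mem_iUnion] at huZ
        obtain ⟨X, ⟨hX, hm⟩, huX⟩ := huZ
        rcases mem_verts_graphOf_attach.mp huY with hu | ⟨x, hx, hu⟩
        · exact hm ⟨u, hu, huX⟩
        · obtain ⟨X', hX', hm', rfl⟩ := hl₂.mp hx
          rw [hτ X' hX'] at hu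
          exact hm (hX.eq_of_mem hX' huX hu ▸ hm')
      by_cases hCY : (C.verts ∩ Y.verts).Nonempty
      · refine ⟨(leaf v).attach l₂, attach_append l₁ l₂ ▸ isNode_attach_self l₁, ?_⟩
        exact hC.2.2 Y (hC.1.le_left_of_le_sup (hC.2.1.trans hle) hYZ hCY) hYle hYconn
      · have hCZ : C ≤ Z := by
          refine hC.1.le_left_of_le_sup (sup_comm Y Z ▸ hC.2.1.trans hle) hYZ.symm ?_
          obtain ⟨u, hu⟩ := hC.1.nonempty
          exact ⟨u, hu, ((hC.2.1.trans hle).1 hu).resolve_left fun h => hCY ⟨u, hu, h⟩⟩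
        have hCH : IsComponent G H C := ⟨hC.1, hCZ.trans hZle, fun D hCD hDH hD =>
          hC.2.2 D hCD (hDH.trans le_sup_right) hD⟩
        exact ⟨τ C, hnode hCH, hτ C hCH⟩

end

/-- Lemma 6 (the `Move' lemma) of the paper. -/
theorem move_lemma (G : SimpleGraph V) [DecidableRel G.Adj]
    (S : Finset V)
    (hindep : ∀ u ∈ S, ∀ w ∈ S, ¬ G.Adj u w)
    (hdeg : ∀ w ∈ S, G.degree w ≤ 9)
    (hgood : IsGood G S)
    (hmax : ∀ S' : Finset V, (∀ u ∈ S', ∀ w ∈ S', ¬ G.Adj u w) →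
      (∀ w ∈ S', G.degree w ≤ 9) → IsGood G S' → PhiGE (phi G S) (phi G S'))
    (i : ℕ) (hi4 : 4 ≤ i) (hi9 : i ≤ 9)
    (v : V) (hv : v ∉ (Hsub G S i).verts)
    (hd4 : 4 ≤ G.degree v) (hdi : G.degree v ≤ i) :
    ∃ X : G.Subgraph, IsComponent G (Hsub G S i) X ∧
      3 ≤ (X.verts ∩ G.neighborSet v).ncard := by
  by_contra! hcon
  have hle : Hsub G S (G.degree v) ≤ Hsub G S i := Hsub_mono hdi
  have hv9 : G.degree v ≤ 9 := hdi.trans hi9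
  have hvd : v ∉ (Hsub G S (G.degree v)).verts := fun h => hv (hle.1 h)
  have hvS : v ∉ S := fun h =>
    hvd ((Gv_le_Hsub (mem_Shat.mpr ⟨h, hd4, le_rfl⟩)).1 (self_mem_verts_Gv v))
  have hnadj : ∀ u ∈ Shat G S (G.degree v), ¬ G.Adj u v := fun u hu h =>
    hvd ((Gv_le_Hsub hu).1 (mem_verts_Gv.mpr (.inr h)))
  refine not_PhiGE_of_PhiGT (phiGT_insert_Shat hvS hd4 hv9) (hmax _ ?_ ?_
    (hgood.insert_Shat hindep hd4 hv9 hvd fun X hX => ?_))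
  · simp only [Finset.mem_insert]
    rintro u (rfl | hu) w (rfl | hw)
    · exact G.irrefl
    · exact fun h => hnadj w hw h.symm
    · exact hnadj u hu
    · exact hindep u (mem_Shat.mp hu).1 w (mem_Shat.mp hw).1
  · simp only [Finset.mem_insert]
    rintro w (rfl | hw)
    · exact hv9
    · exact hdeg w (mem_Shat.mp hw).1
  · obtain ⟨X', hX', hXX'⟩ := exists_isComponent_ge hX.1 (hX.2.1.trans hle)
    refine (Set.ncard_le_ncard ?_ (Set.toFinite _)).trans (Nat.le_of_lt_succ (hcon X' hX'))
    rintro u ⟨huv, huX⟩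
    refine ⟨hXX'.1 huX, (mem_verts_Gv.mp huv).resolve_left ?_⟩
    rintro rfl
    exact hvd (hX.2.1.1 huX)
end

section
/- Let g, s4, s5, s6, s7, s8, s9, u4, u5, u6, u7, u8, v6, v8, w6, w8, a4, a5, a6, a7, a8, a9, a10, z, n, c4, c5, c7, eSN, eN, eNA, eNZ, eA, eAZ, eZ, eU6, eU8, eUY6, eUY8, eY6, eY8, and V be nonnegative real numbers, and write S := s4+s5+s6+s7+s8+s9 and A := a4+a5+a6+a7+a8+a9+a10. Suppose that: (1) S ≤ g; (2) n ≤ 4s4+5s5+6s6+7s7+8s8+9s9; (3) eSN = 4s4+5s5+6s6+7s7+8s8+9s9; (4) u6 ≤ u5+6s6, u7 ≤ u6+7s7, and u8 ≤ u7+8s8; (5) u4 ≤ c4+3s4, u5 ≤ c5+3s4+4s5, and u7 ≤ c7+3s4+4s5+5s6+6s7; (6) 3u6 ≤ 2eU6 and 3u8 ≤ 2eU8; (7) 3v6 ≤ eUY6 and 3v8 ≤ eUY8; (8) 10z ≤ 2eZ+eNZ+eAZ; (9) 4a4+5a5+6a6+7a7+8a8+9a9+10a10 ≤ 2eA+eNA+eAZ;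 (10) 3A ≤ eNA; (11) 4v6+7w6+3(a4+a5+a6) ≤ 7s7+8s8+9s9+eUY6+2eY6+eNZ+eNA; (12) 4v8+9w8+3(a4+a5+a6+a7+a8) ≤ 9s9+eUY8+2eY8+eNZ+eNA; (13) g ≥ S−u4+(1/2)a4+2c4; (14) g ≥ S−u5+(1/2)(a4+a5)+2c5+(1/2)s5; (15) g ≥ S−u7+(1/2)(a4+a5+a6+a7)+2c7+(1/2)(s5+2s6+3s7); (16) n = u6+v6+w6 and n = u8+v8+w8; (17) eN = eU6+eUY6+eY6 and eN = eU8+eUY8+eY8; (18) eSN+eN+eNA+eNZ+eA+eAZ+eZ = 3(V+g−2); (19) V = S+n+A+z. Then 21V ≤ 273g − 72, i.e. V ≤ 13g − 24/7; in particular, if V and g are integers then V ≤ 13g − 4. -/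
theorem linear_programming_implication
    (g s4 s5 s6 s7 s8 s9 u4 u5 u6 u7 u8 v6 v8 w6 w8
      a4 a5 a6 a7 a8 a9 a10 z n c4 c5 c7
      eSN eN eNA eNZ eA eAZ eZ eU6 eU8 eUY6 eUY8 eY6 eY8 V : ℝ)
    (hg : 0 ≤ g) (hs4 : 0 ≤ s4) (hs5 : 0 ≤ s5) (hs6 : 0 ≤ s6) (hs7 : 0 ≤ s7)
    (hs8 : 0 ≤ s8) (hs9 : 0 ≤ s9)
    (hu4 : 0 ≤ u4) (hu5 : 0 ≤ u5) (hu6 : 0 ≤ u6) (hu7 : 0 ≤ u7) (hu8 : 0 ≤ u8)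
    (hv6 : 0 ≤ v6) (hv8 : 0 ≤ v8) (hw6 : 0 ≤ w6) (hw8 : 0 ≤ w8)
    (ha4 : 0 ≤ a4) (ha5 : 0 ≤ a5) (ha6 : 0 ≤ a6) (ha7 : 0 ≤ a7)
    (ha8 : 0 ≤ a8) (ha9 : 0 ≤ a9) (ha10 : 0 ≤ a10)
    (hz : 0 ≤ z) (hn : 0 ≤ n) (hc4 : 0 ≤ c4) (hc5 : 0 ≤ c5) (hc7 : 0 ≤ c7)
    (heSN : 0 ≤ eSN) (heN : 0 ≤ eN) (heNA : 0 ≤ eNA) (heNZ : 0 ≤ eNZ)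
    (heA : 0 ≤ eA) (heAZ : 0 ≤ eAZ) (heZ : 0 ≤ eZ)
    (heU6 : 0 ≤ eU6) (heU8 : 0 ≤ eU8) (heUY6 : 0 ≤ eUY6) (heUY8 : 0 ≤ eUY8)
    (heY6 : 0 ≤ eY6) (heY8 : 0 ≤ eY8) (hV : 0 ≤ V)
    (S : ℝ) (hS : S = s4 + s5 + s6 + s7 + s8 + s9)
    (A : ℝ) (hA : A = a4 + a5 + a6 + a7 + a8 + a9 + a10)
    (h1 : S ≤ g)
    (h2 : n ≤ 4 * s4 + 5 * s5 + 6 * s6 + 7 * s7 + 8 * s8 + 9 * s9)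
    (h3 : eSN = 4 * s4 + 5 * s5 + 6 * s6 + 7 * s7 + 8 * s8 + 9 * s9)
    (h4a : u6 ≤ u5 + 6 * s6) (h4b : u7 ≤ u6 + 7 * s7) (h4c : u8 ≤ u7 + 8 * s8)
    (h5a : u4 ≤ c4 + 3 * s4)
    (h5b : u5 ≤ c5 + 3 * s4 + 4 * s5)
    (h5c : u7 ≤ c7 + 3 * s4 + 4 * s5 + 5 * s6 + 6 * s7)
    (h6a : 3 * u6 ≤ 2 * eU6) (h6b : 3 * u8 ≤ 2 * eU8)
    (h7a : 3 * v6 ≤ eUY6) (h7b : 3 * v8 ≤ eUY8)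
    (h8 : 10 * z ≤ 2 * eZ + eNZ + eAZ)
    (h9 : 4 * a4 + 5 * a5 + 6 * a6 + 7 * a7 + 8 * a8 + 9 * a9 + 10 * a10
            ≤ 2 * eA + eNA + eAZ)
    (h10 : 3 * A ≤ eNA)
    (h11 : 4 * v6 + 7 * w6 + 3 * (a4 + a5 + a6)
            ≤ 7 * s7 + 8 * s8 + 9 * s9 + eUY6 + 2 * eY6 + eNZ + eNA)
    (h12 : 4 * v8 + 9 * w8 + 3 * (a4 + a5 + a6 + a7 + a8)
            ≤ 9 * s9 + eUY8 + 2 * eY8 + eNZ + eNA)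
    (h13 : g ≥ S - u4 + (1 / 2) * a4 + 2 * c4)
    (h14 : g ≥ S - u5 + (1 / 2) * (a4 + a5) + 2 * c5 + (1 / 2) * s5)
    (h15 : g ≥ S - u7 + (1 / 2) * (a4 + a5 + a6 + a7) + 2 * c7
            + (1 / 2) * (s5 + 2 * s6 + 3 * s7))
    (h16a : n = u6 + v6 + w6) (h16b : n = u8 + v8 + w8)
    (h17a : eN = eU6 + eUY6 + eY6) (h17b : eN = eU8 + eUY8 + eY8)
    (h18 : eSN + eN + eNA + eNZ + eA + eAZ + eZ = 3 * (V + g - 2))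
    (h19 : V = S + n + A + z) :
    21 * V ≤ 273 * g - 72 ∧ V ≤ 13 * g - 24 / 7 ∧
      ∀ m k : ℤ, V = (m : ℝ) → g = (k : ℝ) → m ≤ 13 * k - 4 := by
  have key : 21 * V ≤ 273 * g - 72 := by
    subst hS hA
    linarith
  refine ⟨key, by linarith, fun m k hm hk => ?_⟩
  rw [hm, hk] at key
  have key_int : 21 * m ≤ 273 * k - 72 := by exact_mod_cast key
  omega
end
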